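/- arXiv:1708.00567 — 6 statements merged into one kernel-verified Lean document; each statement's English description precedes it below -/
import Mathlib

section
/- Let (V, g) be a finite-dimensional real inner product space, let V₁, …, V_s ∈ V and ξ₁, …, ξ_s ∈ V* satisfy ξ_a(V_b) + ξ_b(V_a) = 0 for all a, b, and suppose the s × s matrix K with entries K_{ab} = g(V_a, V_b) − ξ_a(V_b) is invertible. Let τ₊ = {Y ∈ V : g(Y, V_a) + ξ_a(Y) = 0 for all a}. Then the vectors V₁, …, V_s are linearly independent and V = τ₊ ⊕ span{V₁, …, V_s}; in particular dim τ₊ = dim V − s. -/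
/-- If `φ ∘ T` is bijective, then the kernel of `φ` and the range of `T` are complementary. -/
theorem LinearMap.isCompl_ker_range_of_bijective_comp
    {R M N P : Type*} [Ring R] [AddCommGroup M] [AddCommGroup N] [AddCommGroup P]
    [Module R M] [Module R N] [Module R P] (φ : M →ₗ[R] P) (T : N →ₗ[R] M)
    (h : Function.Bijective (φ ∘ₗ T)) :
    IsCompl (LinearMap.ker φ) (LinearMap.range T) := by
  refine ⟨Submodule.disjoint_def.mpr ?_, codisjoint_iff.mpr (eq_top_iff.mpr ?_)⟩
  · rintro _ hx ⟨c, rfl⟩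
    have hc : c = 0 := h.1 (by simpa using hx)
    simp [hc]
  · intro x _
    obtain ⟨c, hc⟩ := h.2 (φ x)
    refine Submodule.mem_sup.mpr ⟨x - T c, ?_, T c, ⟨c, rfl⟩, by abel⟩
    simpa [sub_eq_zero] using hc.symm

/-- For an isotropic trivially extended action with invertible matrix
`K_{ab} = g(V_a, V_b) − ξ_a(V_b)`, the vectors `V_a` are linearly independent and
`V = τ₊ ⊕ span{V_a}`, where `τ₊ = {Y : g(Y, V_a) + ξ_a(Y) = 0 for all a}`; in particular
`dim τ₊ = dim V − s`. -/
theorem tau_plus_complement_of_orbit_directions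
    (V : Type*) [AddCommGroup V] [Module ℝ V] [FiniteDimensional ℝ V]
    (g : LinearMap.BilinForm ℝ V)
    (hg_symm : ∀ x y, g x y = g y x)
    (hg_pos : ∀ x, x ≠ 0 → 0 < g x x)
    (sharp : Module.Dual ℝ V →ₗ[ℝ] V)
    (hsharp : ∀ ξ, g (sharp ξ) = ξ)
    (hsharp' : ∀ x, sharp (g x) = x)
    (s : ℕ) (Vv : Fin s → V) (ξ : Fin s → Module.Dual ℝ V)
    (h_iso : ∀ a b, ξ a (Vv b) + ξ b (Vv a) = 0)
    (Kmat : Matrix (Fin s) (Fin s) ℝ)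
    (hKmat : ∀ a b, Kmat a b = g (Vv a) (Vv b) - ξ a (Vv b))
    (hK_inv : IsUnit Kmat)
    (τ : Submodule ℝ V)
    (hτ : ∀ Y, Y ∈ τ ↔ ∀ a, g Y (Vv a) + ξ a Y = 0) :
    LinearIndependent ℝ Vv ∧
    IsCompl τ (Submodule.span ℝ (Set.range Vv)) ∧
    Module.finrank ℝ τ = Module.finrank ℝ V - s := by
  let φ : V →ₗ[ℝ] (Fin s → ℝ) := LinearMap.pi fun a => g.flip (Vv a) + ξ a
  have h_comp : φ ∘ₗ Fintype.linearCombination ℝ Vv = Kmat.vecMulLinear := by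
    refine LinearMap.pi_ext' fun b => LinearMap.ext_ring ?_
    ext a
    have h := h_iso a b
    simp [φ, hKmat, Fintype.linearCombination_apply_single]
    linarith
  have h_bij : Function.Bijective (φ ∘ₗ Fintype.linearCombination ℝ Vv) := by
    rw [h_comp]
    exact ⟨Matrix.vecMul_injective_of_isUnit hK_inv, Matrix.vecMul_surjective_iff_isUnit.mpr hK_inv⟩
  have h_ker : τ = LinearMap.ker φ := by
    ext Y
    simp [hτ, φ, funext_iff]
  have h_li : LinearIndependent ℝ Vv :=
    linearIndependent_iff_injective_fintypeLinearCombination.mpr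
      (Function.Injective.of_comp (f := φ) h_bij.1)
  have h_compl : IsCompl τ (Submodule.span ℝ (Set.range Vv)) := by
    rw [h_ker, ← Fintype.range_linearCombination ℝ Vv]
    exact LinearMap.isCompl_ker_range_of_bijective_comp φ _ h_bij
  refine ⟨h_li, h_compl, ?_⟩
  have h_dim := Submodule.finrank_add_eq_of_isCompl h_compl
  rw [finrank_span_eq_card h_li, Fintype.card_fin] at h_dim
  omega
end

section
/- Let (V, g) be a finite-dimensional real inner product space, let V₁, …, V_s ∈ V and ξ₁, …, ξ_s ∈ V* satisfy ξ_a(V_b) + ξ_b(V_a) = 0 for all a, b, and suppose the matrix K with entries K_{ab} = g(V_a, V_b) − ξ_a(V_b) is invertible. Let τ_± = {Y ∈ V : g(Y, V_a) ± ξ_a(Y) = 0 for all a}. Then for every X ∈ τ₊ there is a unique vector X⁻ ∈ τ₋ with X⁻ − X ∈ span{V₁, …, V_s}; explicitly X⁻ = X + Σ_a c^a V_a where the coefficients c^a are the unique solution of Σ_a c^a K_{ba} = 2 ξ_b(X) for all b. The map X ↦ X⁻ is a linear isomorphism from τ₊ onto τ₋. -/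
/-- If the composite of `f` with `c ↦ ∑ a, c a • v a` is multiplication by an invertible matrix,
the span of `v` is a complement of the kernel of `f`. -/
theorem Submodule.isCompl_span_range_of_isUnit_matrix {R M ι : Type*} [CommRing R]
    [AddCommGroup M] [Module R M] [Fintype ι] [DecidableEq ι] {v : ι → M} {f : M →ₗ[R] ι → R}
    {K : Matrix ι ι R} (hK : IsUnit K) (hf : ∀ a b, f (v a) b = K b a) {p : Submodule R M}
    (hp : ∀ x, x ∈ p ↔ f x = 0) : IsCompl (Submodule.span R (Set.range v)) p := by
  have hcomp (c : ι → R) : f (∑ a, c a • v a) = K.mulVec c := by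
    ext b
    simp [hf, Matrix.mulVec, dotProduct, mul_comm]
  constructor
  · rw [Submodule.disjoint_def]
    intro x hx hxp
    obtain ⟨c, rfl⟩ := (Submodule.mem_span_range_iff_exists_fun R).1 hx
    have hc : K.mulVec c = K.mulVec 0 := by
      rw [← hcomp, (hp _).1 hxp, Matrix.mulVec_zero]
    simp [Matrix.mulVec_injective_of_isUnit hK hc]
  · rw [codisjoint_iff, eq_top_iff]
    intro x _
    obtain ⟨c, hc⟩ := Matrix.mulVec_surjective_iff_isUnit.2 hK (f x)
    refine Submodule.mem_sup.2 ⟨∑ a, c a • v a,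
      (Submodule.mem_span_range_iff_exists_fun R).2 ⟨c, rfl⟩, x - ∑ a, c a • v a, ?_, by abel⟩
    rw [hp, map_sub, hcomp, hc, sub_self]

/-- Two complements of `S` are isomorphic by a map that moves vectors along `S`. -/
theorem Submodule.exists_linearEquiv_sub_mem_of_isCompl {R M : Type*} [Ring R]
    [AddCommGroup M] [Module R M] {S p q : Submodule R M} (hp : IsCompl S p) (hq : IsCompl S q) :
    ∃ e : p ≃ₗ[R] q, ∀ x : p, (e x : M) - x ∈ S := by
  refine ⟨(S.quotientEquivOfIsCompl p hp).symm ≪≫ₗ S.quotientEquivOfIsCompl q hq, fun x => ?_⟩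
  rw [← Submodule.Quotient.eq, LinearEquiv.trans_apply, mk_quotientEquivOfIsCompl_apply]
  rfl


/-- Under the metric-reduction hypotheses, every `X ∈ τ₊` has a unique
counterpart `X⁻ ∈ τ₋` with `X⁻ − X ∈ span{V_a}`; explicitly `X⁻ = X + Σ_a c^a V_a` where `c`
is the unique solution of `Σ_a c^a K_{ba} = 2 ξ_b(X)`, and `X ↦ X⁻` is a linear isomorphism
of `τ₊` onto `τ₋`. -/
theorem horizontal_lift_correspondence
    (V : Type*) [AddCommGroup V] [Module ℝ V] [FiniteDimensional ℝ V]
    (g : LinearMap.BilinForm ℝ V)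
    (hg_symm : ∀ x y, g x y = g y x)
    (hg_pos : ∀ x, x ≠ 0 → 0 < g x x)
    (sharp : Module.Dual ℝ V →ₗ[ℝ] V)
    (hsharp : ∀ ξ, g (sharp ξ) = ξ)
    (hsharp' : ∀ x, sharp (g x) = x)
    (s : ℕ) (Vv : Fin s → V) (ξ : Fin s → Module.Dual ℝ V)
    (h_iso : ∀ a b, ξ a (Vv b) + ξ b (Vv a) = 0)
    (Kmat : Matrix (Fin s) (Fin s) ℝ)
    (hKmat : ∀ a b, Kmat a b = g (Vv a) (Vv b) - ξ a (Vv b))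
    (hK_inv : IsUnit Kmat)
    (τp τm : Submodule ℝ V)
    (hτp : ∀ Y, Y ∈ τp ↔ ∀ a, g Y (Vv a) + ξ a Y = 0)
    (hτm : ∀ Y, Y ∈ τm ↔ ∀ a, g Y (Vv a) - ξ a Y = 0) :
    (∀ X ∈ τp, ∃! Y, Y ∈ τm ∧ Y - X ∈ Submodule.span ℝ (Set.range Vv)) ∧
    (∀ X ∈ τp,
      (∃! c : Fin s → ℝ, ∀ b, (∑ a, c a * Kmat b a) = 2 * ξ b X) ∧
      (∀ c : Fin s → ℝ, (∀ b, (∑ a, c a * Kmat b a) = 2 * ξ b X) →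
        (X + ∑ a, c a • Vv a) ∈ τm)) ∧
    (∃ e : τp ≃ₗ[ℝ] τm,
      ∀ X : τp, ((e X : V) - (X : V)) ∈ Submodule.span ℝ (Set.range Vv)) := by
  have hp : IsCompl (Submodule.span ℝ (Set.range Vv)) τp := by
    refine Submodule.isCompl_span_range_of_isUnit_matrix
      (f := LinearMap.pi fun b => g (Vv b) + ξ b) (Kmat.isUnit_transpose.2 hK_inv) (fun a b => ?_) (fun x => ?_)
    · rw [Matrix.transpose_apply, hKmat, hg_symm (Vv a)]
      simp only [LinearMap.pi_apply, LinearMap.add_apply]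
      linarith [h_iso a b]
    · simp [hτp, funext_iff, hg_symm x]
  have hm : IsCompl (Submodule.span ℝ (Set.range Vv)) τm := by
    refine Submodule.isCompl_span_range_of_isUnit_matrix
      (f := LinearMap.pi fun b => g (Vv b) - ξ b) hK_inv (fun a b => ?_) (fun x => ?_)
    · simp [hKmat]
    · simp [hτm, funext_iff, hg_symm x]
  obtain ⟨e, he⟩ := Submodule.exists_linearEquiv_sub_mem_of_isCompl hp hm
  refine ⟨fun X hX => ⟨e ⟨X, hX⟩, ⟨(e _).2, he ⟨X, hX⟩⟩, ?_⟩, fun X hX => ⟨?_, ?_⟩, e, he⟩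
  · rintro Y ⟨hY, hYX⟩
    refine sub_eq_zero.1 (Submodule.disjoint_def.1 hm.disjoint _ ?_ (τm.sub_mem hY (e _).2))
    simpa using Submodule.sub_mem _ hYX (he ⟨X, hX⟩)
  · have hiff (c : Fin s → ℝ) : (∀ b, (∑ a, c a * Kmat b a) = 2 * ξ b X) ↔
        Kmat.mulVec c = fun b => 2 * ξ b X := by
      simp [funext_iff, Matrix.mulVec, dotProduct, mul_comm]
    simp only [hiff]
    exact Function.Bijective.existsUnique ⟨Matrix.mulVec_injective_of_isUnit hK_inv,
      Matrix.mulVec_surjective_iff_isUnit.2 hK_inv⟩ _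
  · intro c hc
    rw [hτm]
    intro b
    have hsum : g (∑ a, c a • Vv a) (Vv b) - ξ b (∑ a, c a • Vv a) = ∑ a, c a * Kmat b a := by
      rw [hg_symm]
      simp [hKmat, mul_sub, Finset.sum_sub_distrib]
    rw [map_add, map_add, LinearMap.add_apply]
    linarith [(hτp X).1 hX b, hc b]
end

section
/- Let (V, g) be a finite-dimensional real inner product space, let V₁, …, V_s ∈ V and ξ₁, …, ξ_s ∈ V* satisfy ξ_a(V_b) + ξ_b(V_a) = 0 for all a, b, and suppose the matrix K with entries K_{ab} = g(V_a, V_b) − ξ_a(V_b) is invertible. Let τ_± = {Y ∈ V : g(Y, V_a) ± ξ_a(Y) = 0 for all a}, and for X ∈ τ₊ let X⁻ denote the unique element of τ₋ with X⁻ − X ∈ span{V₁, …, V_s}. Then for all X, Y ∈ τ₊ one has g(X⁻, Y⁻) = g(X, Y); i.e. the correspondence τ₊ → τ₋ is a linear isometry for g. -/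
/-- Under the metric-reduction hypotheses, the correspondence `τ₊ → τ₋`,
sending `X ∈ τ₊` to the unique `X⁻ ∈ τ₋` with `X⁻ − X ∈ span{V_a}`, is an isometry for `g`:
`g(X⁻, Y⁻) = g(X, Y)` for all `X, Y ∈ τ₊`. -/
theorem horizontal_lift_correspondence_isometry
    (V : Type*) [AddCommGroup V] [Module ℝ V] [FiniteDimensional ℝ V]
    (g : LinearMap.BilinForm ℝ V)
    (hg_symm : ∀ x y, g x y = g y x)
    (hg_pos : ∀ x, x ≠ 0 → 0 < g x x)
    (sharp : Module.Dual ℝ V →ₗ[ℝ] V)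
    (hsharp : ∀ ξ, g (sharp ξ) = ξ)
    (hsharp' : ∀ x, sharp (g x) = x)
    (s : ℕ) (Vv : Fin s → V) (ξ : Fin s → Module.Dual ℝ V)
    (h_iso : ∀ a b, ξ a (Vv b) + ξ b (Vv a) = 0)
    (Kmat : Matrix (Fin s) (Fin s) ℝ)
    (hKmat : ∀ a b, Kmat a b = g (Vv a) (Vv b) - ξ a (Vv b))
    (hK_inv : IsUnit Kmat)
    (τp τm : Submodule ℝ V)
    (hτp : ∀ Y, Y ∈ τp ↔ ∀ a, g Y (Vv a) + ξ a Y = 0)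
    (hτm : ∀ Y, Y ∈ τm ↔ ∀ a, g Y (Vv a) - ξ a Y = 0) :
    ∀ X ∈ τp, ∀ Y ∈ τp, ∀ X' Y' : V,
      X' ∈ τm → X' - X ∈ Submodule.span ℝ (Set.range Vv) →
      Y' ∈ τm → Y' - Y ∈ Submodule.span ℝ (Set.range Vv) →
      g X' Y' = g X Y := by
  have h_pair : ∀ Z ∈ τp, ∀ Z' ∈ τm, ∀ d : Fin s → ℝ,
      2 * g Z (∑ a, d a • Vv a) + g (Z' - Z) (∑ a, d a • Vv a) = ∑ a, d a * ξ a (Z' - Z) := by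
    intro Z hZ Z' hZ' d
    simp only [map_sum, map_smul, smul_eq_mul, Finset.mul_sum, ← Finset.sum_add_distrib,
      map_sub, LinearMap.sub_apply]
    refine Finset.sum_congr rfl fun a _ => ?_
    linear_combination d a * (hτp Z).1 hZ a + d a * (hτm Z').1 hZ' a
  have h_skew : ∀ c d : Fin s → ℝ,
      ∑ a, d a * ξ a (∑ b, c b • Vv b) + ∑ b, c b * ξ b (∑ a, d a • Vv a) = 0 := by
    intro c d
    simp only [map_sum, map_smul, smul_eq_mul, Finset.mul_sum]
    rw [Finset.sum_comm, ← Finset.sum_add_distrib]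
    refine Finset.sum_eq_zero fun b _ => ?_
    rw [← Finset.sum_add_distrib]
    refine Finset.sum_eq_zero fun a _ => ?_
    linear_combination c b * d a * h_iso a b
  intro X hX Y hY X' Y' hX' hXspan hY' hYspan
  obtain ⟨c, hc⟩ := (Submodule.mem_span_range_iff_exists_fun ℝ).1 hXspan
  obtain ⟨d, hd⟩ := (Submodule.mem_span_range_iff_exists_fun ℝ).1 hYspan
  have h1 := h_pair X hX X' hX' d
  have h2 := h_pair Y hY Y' hY' c
  have h3 := h_skew c d
  rw [hc, hd] at h3
  rw [hd] at h1
  rw [hc] at h2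
  simp only [map_sub, LinearMap.sub_apply] at h1 h2 h3
  linarith [hg_symm X Y, hg_symm X' Y, hg_symm X Y', hg_symm X' Y']
end

section
/- Let (W, ⟨·,·⟩) be a finite-dimensional real vector space with a nondegenerate symmetric bilinear form, let 𝒢 : W → W be a generalized metric (orthogonal, self-adjoint, with ⟨𝒢x, x⟩ > 0 for x ≠ 0), and let K ⊆ W be an isotropic subspace. Define K^𝒢 = {x ∈ K^⊥ : ⟨𝒢x, k⟩ = 0 for all k ∈ K}, the 𝒢-orthogonal complement of K inside K^⊥. Then K^⊥ = K ⊕ K^𝒢, the quotient projection K^⊥ → K^⊥/K restricts to a linear isomorphism K^𝒢 ≅ K^⊥/K, and moreover K^𝒢 = K^⊥ ∩ 𝒢(K^⊥). -/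
/-- A self-adjoint isometry of a nondegenerate symmetric form is an involution. -/
theorem LinearMap.BilinForm.apply_apply_eq_self_of_isometry_of_selfAdjoint
    {R M : Type*} [CommRing R] [AddCommGroup M] [Module R M]
    {B : LinearMap.BilinForm R M} (hB : B.Nondegenerate) {G : M →ₗ[R] M}
    (hG_orth : ∀ x y, B (G x) (G y) = B x y)
    (hG_selfadj : ∀ x y, B (G x) y = B x (G y)) (x : M) : G (G x) = x := by
  refine sub_eq_zero.mp (hB.1 _ fun y => ?_)
  rw [map_sub, LinearMap.sub_apply, hG_selfadj, hG_orth, sub_self]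

/-- With respect to a positive definite symmetric bilinear form, every vector of a
finite-dimensional space differs from an element of a given subspace by a vector orthogonal
to that subspace. -/
theorem LinearMap.BilinForm.exists_mem_forall_apply_sub_eq_zero
    {V : Type*} [AddCommGroup V] [Module ℝ V] [FiniteDimensional ℝ V]
    (g : LinearMap.BilinForm ℝ V) (hg_symm : ∀ x y, g x y = g y x)
    (hg_pos : ∀ x, x ≠ 0 → 0 < g x x) (K : Submodule ℝ V) (x : V) :
    ∃ k ∈ K, ∀ k' ∈ K, g (x - k) k' = 0 := by
  have hrefl : g.IsRefl := fun a b h => by rw [hg_symm, h]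
  have hdisj : Disjoint K (g.orthogonal K) := by
    refine Submodule.disjoint_def.mpr fun a ha ha' => ?_
    by_contra hne
    exact (hg_pos a hne).ne' (ha' a ha)
  have hcompl := (LinearMap.BilinForm.isCompl_orthogonal_iff_disjoint hrefl).mpr hdisj
  obtain ⟨k, hk, y, hy, rfl⟩ :=
    Submodule.mem_sup.mp (hcompl.sup_eq_top ▸ Submodule.mem_top : x ∈ K ⊔ g.orthogonal K)
  refine ⟨k, hk, fun k' hk' => ?_⟩
  rw [add_sub_cancel_left, hg_symm]
  exact hy k' hk'


/-- Let `𝒢` be a generalized metric on `(W, B)` and `K` an isotropic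
subspace, with `K^𝒢 = {x ∈ K^⊥ : ⟨𝒢x, k⟩ = 0 for all k ∈ K}`.  Then `K^⊥ = K ⊕ K^𝒢`,
the quotient projection `K^⊥ → K^⊥/K` restricts to an isomorphism `K^𝒢 ≅ K^⊥/K`, and
`K^𝒢 = K^⊥ ∩ 𝒢(K^⊥)`. -/
theorem KG_complement_of_K_in_Kperp
    (W : Type*) [AddCommGroup W] [Module ℝ W] [FiniteDimensional ℝ W]
    (B : LinearMap.BilinForm ℝ W)
    (hB_symm : ∀ x y, B x y = B y x)
    (hB_nondeg : B.Nondegenerate)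
    (G : W →ₗ[ℝ] W)
    (hG_orth : ∀ x y, B (G x) (G y) = B x y)
    (hG_selfadj : ∀ x y, B (G x) y = B x (G y))
    (hG_pos : ∀ x, x ≠ 0 → 0 < B (G x) x)
    (K : Submodule ℝ W)
    (hK_iso : ∀ k ∈ K, ∀ k' ∈ K, B k k' = 0)
    (Kperp : Submodule ℝ W)
    (hKperp : ∀ x, x ∈ Kperp ↔ ∀ k ∈ K, B x k = 0)
    (KG : Submodule ℝ W)
    (hKG : ∀ x, x ∈ KG ↔ x ∈ Kperp ∧ ∀ k ∈ K, B (G x) k = 0) :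
    (K ⊓ KG = ⊥ ∧ K ⊔ KG = Kperp) ∧
    Function.Bijective
      ((K.comap Kperp.subtype).mkQ ∘ₗ
        Submodule.inclusion (fun x hx => ((hKG x).mp hx).1 : KG ≤ Kperp)) ∧
    KG = Kperp ⊓ Submodule.map G Kperp := by
  have hGG := LinearMap.BilinForm.apply_apply_eq_self_of_isometry_of_selfAdjoint
    hB_nondeg hG_orth hG_selfadj
  have hK_le : K ≤ Kperp := fun k hk => (hKperp k).mpr (hK_iso k hk)
  have hKG_le : KG ≤ Kperp := fun x hx => ((hKG x).mp hx).1
  have hzero : ∀ x ∈ K, x ∈ KG → x = 0 := by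
    intro x hxK hxKG
    by_contra hne
    exact (hG_pos x hne).ne' (((hKG x).mp hxKG).2 x hxK)
  have hdecomp : ∀ x ∈ Kperp, ∃ k ∈ K, x - k ∈ KG := by
    intro x hx
    obtain ⟨k, hk, hxk⟩ := LinearMap.BilinForm.exists_mem_forall_apply_sub_eq_zero
      (B ∘ₗ G) (fun a b => (hG_selfadj a b).trans (hB_symm a (G b))) hG_pos K x
    exact ⟨k, hk, (hKG _).mpr ⟨Kperp.sub_mem hx (hK_le hk), hxk⟩⟩
  refine ⟨⟨?_, ?_⟩, ⟨?_, ?_⟩, ?_⟩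
  · exact (Submodule.disjoint_def.mpr hzero).eq_bot
  · refine le_antisymm (sup_le hK_le hKG_le) fun x hx => ?_
    obtain ⟨k, hk, hxk⟩ := hdecomp x hx
    exact Submodule.mem_sup.mpr ⟨k, hk, x - k, hxk, add_sub_cancel k x⟩
  · refine (injective_iff_map_eq_zero _).mpr fun x hx => Subtype.ext ?_
    have hxK := (Submodule.Quotient.mk_eq_zero (K.comap Kperp.subtype)).mp hx
    exact hzero x hxK x.2
  · intro q
    obtain ⟨x, rfl⟩ := Submodule.mkQ_surjective _ q
    obtain ⟨k, hk, hxk⟩ := hdecomp x x.2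
    refine ⟨⟨x - k, hxk⟩, (Submodule.Quotient.eq _).mpr ?_⟩
    simpa using hk
  · ext x
    rw [hKG, Submodule.mem_inf, Submodule.mem_map]
    refine and_congr_right fun _ => ⟨fun h => ⟨G x, (hKperp _).mpr h, hGG x⟩, ?_⟩
    rintro ⟨y, hy, rfl⟩
    rw [hGG]
    exact (hKperp y).mp hy
end

section
/- Let (W, ⟨·,·⟩) be a finite-dimensional real vector space with a nondegenerate symmetric bilinear form, let 𝒢 : W → W be a generalized metric (orthogonal, self-adjoint, with ⟨𝒢x, x⟩ > 0 for x ≠ 0) with eigenspaces W₊ = ker(𝒢 − id) and W₋ = ker(𝒢 + id), and let K ⊆ W be an isotropic subspace with K^𝒢 = {x ∈ K^⊥ : ⟨𝒢x, k⟩ = 0 for all k ∈ K}. Then 𝒢(K^𝒢) = K^𝒢, the restriction of ⟨·,·⟩ to K^𝒢 is nondegenerate, and K^𝒢 = (W₊ ∩ K^𝒢) ⊕ (W₋ ∩ K^𝒢). -/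
/-- Let `𝒢` be a generalized metric on `(W, B)` with eigenspaces
`W₊ = ker(𝒢 − id)` and `W₋ = ker(𝒢 + id)`, and let `K` be isotropic with
`K^𝒢 = {x ∈ K^⊥ : ⟨𝒢x, k⟩ = 0 for all k ∈ K}`.  Then `𝒢(K^𝒢) = K^𝒢`, the restriction of
`B` to `K^𝒢` is nondegenerate, and `K^𝒢 = (W₊ ∩ K^𝒢) ⊕ (W₋ ∩ K^𝒢)`. -/
theorem KG_metric_decomposition
    (W : Type*) [AddCommGroup W] [Module ℝ W] [FiniteDimensional ℝ W]
    (B : LinearMap.BilinForm ℝ W)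
    (hB_symm : ∀ x y, B x y = B y x)
    (hB_nondeg : B.Nondegenerate)
    (G : W →ₗ[ℝ] W)
    (hG_orth : ∀ x y, B (G x) (G y) = B x y)
    (hG_selfadj : ∀ x y, B (G x) y = B x (G y))
    (hG_pos : ∀ x, x ≠ 0 → 0 < B (G x) x)
    (Wp Wm : Submodule ℝ W)
    (hWp : Wp = LinearMap.ker (G - LinearMap.id))
    (hWm : Wm = LinearMap.ker (G + LinearMap.id))
    (K : Submodule ℝ W)
    (hK_iso : ∀ k ∈ K, ∀ k' ∈ K, B k k' = 0)
    (Kperp : Submodule ℝ W)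
    (hKperp : ∀ x, x ∈ Kperp ↔ ∀ k ∈ K, B x k = 0)
    (KG : Submodule ℝ W)
    (hKG : ∀ x, x ∈ KG ↔ x ∈ Kperp ∧ ∀ k ∈ K, B (G x) k = 0) :
    Submodule.map G KG = KG ∧
    (∀ x ∈ KG, (∀ y ∈ KG, B x y = 0) → x = 0) ∧
    ((Wp ⊓ KG) ⊓ (Wm ⊓ KG) = ⊥ ∧ (Wp ⊓ KG) ⊔ (Wm ⊓ KG) = KG) := by
  have hGG : ∀ x, G (G x) = x := by
    intro x
    by_contra h
    have hpos := hG_pos (G (G x) - x) (sub_ne_zero.mpr h)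
    have hzero : B (G (G x) - x) (G (G (G x) - x)) = 0 := by
      rw [map_sub B, LinearMap.sub_apply, hG_orth, hG_selfadj, sub_self]
    rw [hG_selfadj, hzero] at hpos
    exact lt_irrefl _ hpos
  have hGmem : ∀ x ∈ KG, G x ∈ KG := by
    intro x hx
    obtain ⟨hperp, hG⟩ := (hKG x).mp hx
    refine (hKG _).mpr ⟨(hKperp _).mpr hG, ?_⟩
    rw [hGG]
    exact (hKperp x).mp hperp
  refine ⟨?_, ?_, ?_, ?_⟩
  · ext x
    constructor
    · rintro ⟨y, hy, rfl⟩
      exact hGmem y hy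
    · exact fun hx => ⟨G x, hGmem x hx, hGG x⟩
  · intro x hx h
    by_contra hne
    have hpos := hG_pos x hne
    rw [hG_selfadj, h _ (hGmem x hx)] at hpos
    exact lt_irrefl _ hpos
  · subst hWp hWm
    rw [eq_bot_iff]
    rintro x ⟨⟨hp, -⟩, ⟨hm, -⟩⟩
    have hp' : G x = x := sub_eq_zero.mp hp
    have hm' : G x + x = 0 := hm
    rw [hp', ← two_smul ℝ x] at hm'
    exact (smul_eq_zero.mp hm').resolve_left two_ne_zero
  · subst hWp hWm
    refine le_antisymm (sup_le inf_le_right inf_le_right) fun x hx => ?_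
    refine Submodule.mem_sup.mpr ⟨(1 / 2 : ℝ) • (x + G x), ⟨?_, ?_⟩,
      (1 / 2 : ℝ) • (x - G x), ⟨?_, ?_⟩, by module⟩
    · change G ((1 / 2 : ℝ) • (x + G x)) - (1 / 2 : ℝ) • (x + G x) = 0
      rw [map_smul, map_add, hGG]
      module
    · exact KG.smul_mem _ (KG.add_mem hx (hGmem x hx))
    · change G ((1 / 2 : ℝ) • (x - G x)) + (1 / 2 : ℝ) • (x - G x) = 0
      rw [map_smul, map_sub, hGG]
      module
    · exact KG.smul_mem _ (KG.sub_mem hx (hGmem x hx))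
end

section
/- Let V be a finite-dimensional real inner product space with inner product g, let W = V × V* carry the natural pairing ⟨(X, ξ), (Y, η)⟩ = ξ(Y) + η(X), and let 𝒢(X, ξ) = (♯ξ, ♭X) be the generalized metric determined by g, with eigenspaces V₊ = {(X, ♭X)} and V₋ = {(X, −♭X)}. Let V₁, …, V_s ∈ V and ξ₁, …, ξ_s ∈ V* satisfy ξ_a(V_b) + ξ_b(V_a) = 0 for all a, b, let K = span{(V_a, ξ_a) : a = 1, …, s} (which is isotropic), and let K^𝒢 = {w ∈ K^⊥ : ⟨𝒢w, k⟩ = 0 for all k ∈ K}. Then V₊ ∩ K^𝒢 = {(X, ♭X) : X ∈ τ₊} and V₋ ∩ K^𝒢 = {(X, −♭X) : X ∈ τ₋}, where τ_± = {Y ∈ V : g(Y, V_a) ± ξ_a(Y) = 0 for all a}. -/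
/-- The natural pairing `⟨(X, ξ), (Y, η)⟩ = ξ(Y) + η(X)` on the generalized tangent space
`W = V × V*`. -/
def natPairing (V : Type*) [AddCommGroup V] [Module ℝ V] :
    (V × Module.Dual ℝ V) → (V × Module.Dual ℝ V) → ℝ :=
  fun w₁ w₂ => w₁.2 w₂.1 + w₂.2 w₁.1

theorem natPairing_add_right {V : Type*} [AddCommGroup V] [Module ℝ V]
    (w x y : V × Module.Dual ℝ V) :
    natPairing V w (x + y) = natPairing V w x + natPairing V w y := by
  simp only [natPairing, Prod.fst_add, Prod.snd_add, map_add, LinearMap.add_apply]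
  ring

theorem natPairing_smul_right {V : Type*} [AddCommGroup V] [Module ℝ V]
    (c : ℝ) (w x : V × Module.Dual ℝ V) :
    natPairing V w (c • x) = c * natPairing V w x := by
  simp only [natPairing, Prod.smul_fst, Prod.smul_snd, map_smul, LinearMap.smul_apply, smul_eq_mul]
  ring

theorem natPairing_comm {V : Type*} [AddCommGroup V] [Module ℝ V]
    (w x : V × Module.Dual ℝ V) : natPairing V w x = natPairing V x w :=
  add_comm _ _

/-- A vector is orthogonal to a span if and only if it is orthogonal to the generators. -/
theorem natPairing_span_range_eq_zero_iff {V ι : Type*} [AddCommGroup V] [Module ℝ V]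
    (w : V × Module.Dual ℝ V) (v : ι → V × Module.Dual ℝ V) :
    (∀ k ∈ Submodule.span ℝ (Set.range v), natPairing V w k = 0) ↔
      ∀ a, natPairing V w (v a) = 0 := by
  refine ⟨fun h a => h _ (Submodule.subset_span ⟨a, rfl⟩), fun h k hk => ?_⟩
  induction hk using Submodule.span_induction with
  | mem x hx => obtain ⟨a, rfl⟩ := hx; exact h a
  | zero => simp [natPairing]
  | add x y _ _ hx hy => rw [natPairing_add_right, hx, hy, add_zero]
  | smul c x _ hx => rw [natPairing_smul_right, hx, mul_zero]

/-- For the generalized metric `𝒢(X, ξ) = (♯ξ, ♭X)` on `W = V × V*` with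
eigenspaces `V₊ = {(X, ♭X)}`, `V₋ = {(X, −♭X)}`, and an isotropic `K = span{(V_a, ξ_a)}`
(with `ξ_a(V_b) + ξ_b(V_a) = 0`), one has `V₊ ∩ K^𝒢 = {(X, ♭X) : X ∈ τ₊}` and
`V₋ ∩ K^𝒢 = {(X, −♭X) : X ∈ τ₋}`, where
`τ_± = {Y : g(Y, V_a) ± ξ_a(Y) = 0 for all a}`. -/
theorem reduced_eigenbundles_are_horizontal_distributions
    (V : Type*) [AddCommGroup V] [Module ℝ V] [FiniteDimensional ℝ V]
    (g : LinearMap.BilinForm ℝ V)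
    (hg_symm : ∀ x y, g x y = g y x)
    (hg_pos : ∀ x, x ≠ 0 → 0 < g x x)
    (sharp : Module.Dual ℝ V →ₗ[ℝ] V)
    (hsharp : ∀ ξ, g (sharp ξ) = ξ)
    (hsharp' : ∀ x, sharp (g x) = x)
    (G : (V × Module.Dual ℝ V) → (V × Module.Dual ℝ V))
    (hG : ∀ w, G w = (sharp w.2, g w.1))
    (s : ℕ) (Vv : Fin s → V) (ξ : Fin s → Module.Dual ℝ V)
    (h_iso : ∀ a b, ξ a (Vv b) + ξ b (Vv a) = 0)
    (K : Submodule ℝ (V × Module.Dual ℝ V))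
    (hK : K = Submodule.span ℝ (Set.range fun a => (Vv a, ξ a)))
    (KG : Set (V × Module.Dual ℝ V))
    (hKG : ∀ w, w ∈ KG ↔
      (∀ k ∈ K, natPairing V w k = 0) ∧ (∀ k ∈ K, natPairing V (G w) k = 0))
    (τp τm : Set V)
    (hτp : ∀ Y, Y ∈ τp ↔ ∀ a, g Y (Vv a) + ξ a Y = 0)
    (hτm : ∀ Y, Y ∈ τm ↔ ∀ a, g Y (Vv a) - ξ a Y = 0) :
    (∀ w₁ ∈ K, ∀ w₂ ∈ K, natPairing V w₁ w₂ = 0) ∧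
    ({w : V × Module.Dual ℝ V | (∃ X : V, w = (X, g X)) ∧ w ∈ KG}
      = {w : V × Module.Dual ℝ V | ∃ X ∈ τp, w = (X, g X)}) ∧
    ({w : V × Module.Dual ℝ V | (∃ X : V, w = (X, -(g X))) ∧ w ∈ KG}
      = {w : V × Module.Dual ℝ V | ∃ X ∈ τm, w = (X, -(g X))}) := by
  subst hK
  simp only [natPairing_span_range_eq_zero_iff] at hKG ⊢
  refine ⟨fun w₁ hw₁ a => ?_, ?_, ?_⟩
  · rw [natPairing_comm]
    exact (natPairing_span_range_eq_zero_iff (Vv a, ξ a) fun b => (Vv b, ξ b)).2 (h_iso a) w₁ hw₁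
  · have key : ∀ X, (X, g X) ∈ KG ↔ X ∈ τp := fun X => by
      simp [hKG, hτp, hG, hsharp', natPairing]
    ext w
    constructor
    · rintro ⟨⟨X, rfl⟩, h⟩
      exact ⟨X, (key X).1 h, rfl⟩
    · rintro ⟨X, hX, rfl⟩
      exact ⟨⟨X, rfl⟩, (key X).2 hX⟩
  · have key : ∀ X, (X, -(g X)) ∈ KG ↔ X ∈ τm := fun X => by
      simp only [hKG, hτm, hG, hsharp', natPairing, map_neg, LinearMap.neg_apply]
      exact ⟨fun h a => by linarith [h.2 a],
        fun h => ⟨fun a => by linarith [h a], fun a => by linarith [h a]⟩⟩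
    ext w
    constructor
    · rintro ⟨⟨X, rfl⟩, h⟩
      exact ⟨X, (key X).1 h, rfl⟩
    · rintro ⟨X, hX, rfl⟩
      exact ⟨⟨X, rfl⟩, (key X).2 hX⟩
end
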